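/- Let P be a d-dimensional integer polytope in ℝ^d, d ≥ 3, all of whose facets are centrally symmetric. Then P is a concrete polytope: A_P(t) = vol(P)·t^d for all positive integers t. -/

import Mathlib

open scoped BigOperators
open MeasureTheory
attribute [local instance] Classical.propDecidable

/-- The Euclidean ball of radius `ε` around `c` in `ℝ^d`. -/
def eball {d : ℕ} (c : Fin d → ℝ) (ε : ℝ) : Set (Fin d → ℝ) :=
  {y | ∑ i, (y i - c i) ^ 2 < ε ^ 2}

/-- `saTendsto Q c ω` says that the solid angle of `Q` at `c` exists and equals `ω`:
the proportion of a small Euclidean ball around `c` occupied by `Q` tends to `ω`. -/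
def saTendsto {d : ℕ} (Q : Set (Fin d → ℝ)) (c : Fin d → ℝ) (ω : ℝ) : Prop :=
  Filter.Tendsto
    (fun ε : ℝ => (volume (eball c ε ∩ Q)).toReal / (volume (eball c ε)).toReal)
    (nhdsWithin 0 (Set.Ioi 0)) (nhds ω)

open Pointwise

/-- `F` is a facet of the polytope `P ⊆ ℝ^d`: the intersection of `P` with a supporting
hyperplane, of dimension `d-1`. -/
def IsFacet {d : ℕ} (P F : Set (Fin d → ℝ)) : Prop :=
  ∃ u : Fin d → ℝ, u ≠ 0 ∧ ∃ c : ℝ,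
    (∀ x ∈ P, ∑ i, u i * x i ≤ c) ∧
    F = {x ∈ P | ∑ i, u i * x i = c} ∧
    Module.finrank ℝ (affineSpan ℝ F).direction = d - 1

/-- A set `S` is centrally symmetric: `S = 2c - S` for some center `c`. -/
def CentrallySymm {d : ℕ} (S : Set (Fin d → ℝ)) : Prop :=
  ∃ c : Fin d → ℝ, (fun y => (2 : ℝ) • c - y) '' S = S

namespace Conc

/-- The segment from `y` to `y+w` hits `A`. -/
def Hit {d : ℕ} (A : Set (Fin d → ℝ)) (w y : Fin d → ℝ) : Prop :=
  ∃ s : ℝ, 0 ≤ s ∧ s ≤ 1 ∧ y + s • w ∈ A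

/-- Segment from `y` to `y+w` hits `P` and ends outside. -/
def Ex {d : ℕ} (P : Set (Fin d → ℝ)) (w y : Fin d → ℝ) : Prop :=
  Hit P w y ∧ y + w ∉ P

/-- `F` is a facet through which the direction `w` leaves `P`. -/
def Fac {d : ℕ} (P : Set (Fin d → ℝ)) (w : Fin d → ℝ) (F : Set (Fin d → ℝ)) : Prop :=
  ∃ f : (Fin d → ℝ) →ₗ[ℝ] ℝ, ∃ c : ℝ, (∀ x ∈ P, f x ≤ c) ∧ F = {x ∈ P | f x = c} ∧
    Module.finrank ℝ (affineSpan ℝ F).direction = d - 1 ∧ 0 < f w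

/-- Generic directions. -/
def GoodDir {d : ℕ} (V : Finset (Fin d → ℝ)) (w : Fin d → ℝ) : Prop :=
  ∀ A ⊆ V, Module.finrank ℝ (affineSpan ℝ (A : Set (Fin d → ℝ))).direction < d →
    w ∉ (affineSpan ℝ (A : Set (Fin d → ℝ))).direction

/-- Generic base points. -/
def GoodPt {d : ℕ} (V : Finset (Fin d → ℝ)) (w y : Fin d → ℝ) : Prop :=
  ∀ A ⊆ V,
    (Module.finrank ℝ (affineSpan ℝ (A : Set (Fin d → ℝ))).direction + 1 < d →
      ∀ s : ℝ, y + s • w ∉ affineSpan ℝ (A : Set (Fin d → ℝ))) ∧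
    (Module.finrank ℝ (affineSpan ℝ (A : Set (Fin d → ℝ))).direction < d →
      y + w ∉ affineSpan ℝ (A : Set (Fin d → ℝ)))

theorem Fac.isFacet {d : ℕ} {P : Set (Fin d → ℝ)} {w : Fin d → ℝ} {F : Set (Fin d → ℝ)}
    (h : Fac P w F) : IsFacet P F := by
  obtain ⟨f, c, h1, h2, h3, h4⟩ := h
  have key : ∀ x, f x = ∑ i, f (Pi.single i 1) * x i := by
    intro x
    conv_lhs => rw [LinearMap.pi_apply_eq_sum_univ f x]
    refine Finset.sum_congr rfl fun i _ => ?_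
    rw [smul_eq_mul, mul_comm]
    congr 2
    ext j
    simp [Pi.single_apply, eq_comm]
  refine ⟨fun i => f (Pi.single i 1), ?_, c, ?_, ?_, h3⟩
  · intro h0
    have := key w
    have h5 : ∀ i, f (Pi.single i 1) = 0 := fun i => congrFun h0 i
    simp [h5] at this
    linarith
  · intro x hx; rw [← key]; exact h1 x hx
  · rw [h2]; ext x; simp only [Set.mem_ofPred_eq, ← key]

theorem face_eq {d : ℕ} (V : Finset (Fin d → ℝ)) (f : (Fin d → ℝ) →ₗ[ℝ] ℝ) (c : ℝ)
    (hf : ∀ x ∈ convexHull ℝ (V : Set (Fin d → ℝ)), f x ≤ c) :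
    {x ∈ convexHull ℝ (V : Set (Fin d → ℝ)) | f x = c} =
      convexHull ℝ ((V.filter (fun v => f v = c) : Finset _) : Set (Fin d → ℝ)) := by
  classical
  apply Set.Subset.antisymm
  · rintro x ⟨hx, hxc⟩
    rw [Finset.mem_convexHull'] at hx ⊢
    obtain ⟨a, ha0, ha1, hax⟩ := hx
    have hz : ∑ v ∈ V, a v * (c - f v) = 0 := by
      have : f x = ∑ v ∈ V, a v * f v := by rw [← hax]; simp
      simp only [mul_sub, Finset.sum_sub_distrib, ← Finset.sum_mul, ha1, ← this, hxc]; simp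
    have hV : ∀ v ∈ V, f v ≤ c := fun v hv => hf v (subset_convexHull ℝ _ hv)
    rw [Finset.sum_eq_zero_iff_of_nonneg
      (fun v hv => mul_nonneg (ha0 v hv) (sub_nonneg.2 (hV v hv)))] at hz
    have hz' : ∀ v ∈ V, f v ≠ c → a v = 0 := by
      intro v hv hne
      rcases mul_eq_zero.1 (hz v hv) with h | h
      · exact h
      · exact absurd (by linarith) hne
    refine ⟨a, fun y hy => ha0 y (Finset.mem_filter.1 hy).1, ?_, ?_⟩
    · rw [← ha1, Finset.sum_filter]
      refine Finset.sum_congr rfl fun v hv => ?_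
      split_ifs with h
      · rfl
      · exact (hz' v hv h).symm
    · rw [← hax, Finset.sum_filter]
      refine Finset.sum_congr rfl fun v hv => ?_
      split_ifs with h
      · rfl
      · simp [hz' v hv h]
  · intro x hx
    refine ⟨convexHull_mono (by intro v hv; simp at hv; exact hv.1) hx, ?_⟩
    have hc : Convex ℝ {x | f x = c} := convex_hyperplane f.isLinear c
    exact convexHull_min (by intro v hv; simp at hv; exact hv.2) hc hx

theorem Fac.eq_hull {d : ℕ} {V : Finset (Fin d → ℝ)} {w : Fin d → ℝ} {F : Set (Fin d → ℝ)}
    (h : Fac (convexHull ℝ (V : Set (Fin d → ℝ))) w F) :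
    ∃ A ⊆ V, F = convexHull ℝ (A : Set (Fin d → ℝ)) := by
  obtain ⟨f, c, h1, h2, h3, h4⟩ := h
  exact ⟨_, Finset.filter_subset _ _, h2.trans (face_eq V f c h1)⟩

theorem fac_finite {d : ℕ} (V : Finset (Fin d → ℝ)) (w : Fin d → ℝ) :
    {F | Fac (convexHull ℝ (V : Set (Fin d → ℝ))) w F}.Finite := by
  refine Set.Finite.subset (((V.powerset : Finset (Finset (Fin d → ℝ))).finite_toSet).image
    (fun A : Finset (Fin d → ℝ) => convexHull ℝ (A : Set (Fin d → ℝ)))) ?_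
  intro F hF
  obtain ⟨A, hA, rfl⟩ := hF.eq_hull
  exact ⟨A, by simpa using hA, rfl⟩

/-- Two facets meeting at a generic point coincide. -/
theorem fac_unique {d : ℕ} (hd : 1 ≤ d) {V : Finset (Fin d → ℝ)} {w : Fin d → ℝ}
    {F G : Set (Fin d → ℝ)}
    (hF : Fac (convexHull ℝ (V : Set (Fin d → ℝ))) w F)
    (hG : Fac (convexHull ℝ (V : Set (Fin d → ℝ))) w G) {p : Fin d → ℝ} (hpF : p ∈ F) (hpG : p ∈ G)
    (hp : ∀ A ⊆ V, Module.finrank ℝ (affineSpan ℝ (A : Set (Fin d → ℝ))).direction + 1 < d →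
      p ∉ affineSpan ℝ (A : Set (Fin d → ℝ))) : F = G := by
  classical
  obtain ⟨f, c, f1, f2, f3, f4⟩ := hF
  obtain ⟨g, e, g1, g2, g3, g4⟩ := hG
  set P := convexHull ℝ (V : Set (Fin d → ℝ)) with hP
  have hI : F ∩ G = {x ∈ P | (f + g) x = c + e} := by
    rw [f2, g2]; ext x
    simp only [Set.mem_inter_iff, Set.mem_ofPred_eq, LinearMap.add_apply]
    constructor
    · rintro ⟨⟨h1, h2⟩, h3, h4⟩; exact ⟨h1, by linarith⟩
    · rintro ⟨h1, h2⟩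
      have := f1 x h1; have := g1 x h1
      exact ⟨⟨h1, by linarith⟩, h1, by linarith⟩
  have hfg : ∀ x ∈ P, (f + g) x ≤ c + e := fun x hx => add_le_add (f1 x hx) (g1 x hx)
  rw [face_eq V _ _ hfg] at hI
  set A := V.filter (fun v => (f + g) v = c + e) with hA
  have hpI : p ∈ F ∩ G := ⟨hpF, hpG⟩
  have hpA : p ∈ affineSpan ℝ (A : Set (Fin d → ℝ)) := by
    rw [hI] at hpI
    exact convexHull_subset_affineSpan _ hpI
  have hspan : affineSpan ℝ (F ∩ G) = affineSpan ℝ (A : Set (Fin d → ℝ)) := by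
    rw [hI, affineSpan_convexHull]
  have hrank : d ≤ Module.finrank ℝ (affineSpan ℝ (A : Set (Fin d → ℝ))).direction + 1 := by
    by_contra hlt
    exact hp A (Finset.filter_subset _ _) (by omega) hpA
  have main : ∀ K : Set (Fin d → ℝ), F ∩ G ⊆ K →
      Module.finrank ℝ (affineSpan ℝ K).direction = d - 1 →
      affineSpan ℝ (A : Set (Fin d → ℝ)) = affineSpan ℝ K := by
    intro K hK hr
    have hle : affineSpan ℝ (A : Set (Fin d → ℝ)) ≤ affineSpan ℝ K := by
      rw [← hspan]; exact affineSpan_mono ℝ hK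
    have hdle := AffineSubspace.direction_le hle
    refine AffineSubspace.eq_of_direction_eq_of_nonempty_of_le ?_ ⟨p, hpA⟩ hle
    refine Submodule.eq_of_le_of_finrank_eq hdle ?_
    have := Submodule.finrank_mono hdle
    omega
  have hFs := main F Set.inter_subset_left f3
  have hGs := main G Set.inter_subset_right g3
  have hFG : affineSpan ℝ F = affineSpan ℝ G := hFs.symm.trans hGs
  have sub : ∀ (K : Set (Fin d → ℝ)) (k : (Fin d → ℝ) →ₗ[ℝ] ℝ) (a : ℝ), K = {x ∈ P | k x = a} →
      ∀ x ∈ affineSpan ℝ K, k x = a := by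
    intro K k a hK x hx
    let S : AffineSubspace ℝ (Fin d → ℝ) :=
      (AffineSubspace.mk' a (⊥ : Submodule ℝ ℝ)).comap k.toAffineMap
    have : affineSpan ℝ K ≤ S := by
      rw [affineSpan_le]
      intro z hz
      rw [hK] at hz
      simp [S, AffineSubspace.mem_mk', hz.2]
    have := this hx
    simp [S, AffineSubspace.mem_mk', sub_eq_zero] at this
    exact this
  apply Set.Subset.antisymm
  · intro x hx
    have hxG : x ∈ affineSpan ℝ G := hFG ▸ subset_affineSpan ℝ F hx
    have := sub G g e g2 x hxG
    rw [f2] at hx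
    rw [g2]; exact ⟨hx.1, this⟩
  · intro x hx
    have hxF : x ∈ affineSpan ℝ F := hFG ▸ subset_affineSpan ℝ G hx
    have := sub F f c f2 x hxF
    rw [g2] at hx
    rw [f2]; exact ⟨hx.1, this⟩

/-- existence of an exit facet -/
theorem exists_exit {d : ℕ} (hd : 1 ≤ d) {V : Finset (Fin d → ℝ)} {w y : Fin d → ℝ}
    (hinter : (interior (convexHull ℝ (V : Set (Fin d → ℝ)))).Nonempty)
    (hw : GoodDir V w) (hy : GoodPt V w y)
    {s₀ : ℝ} (h1 : s₀ < 1)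
    (hp : y + s₀ • w ∈ convexHull ℝ (V : Set (Fin d → ℝ)))
    (hout : ∀ s, s₀ < s → s ≤ 1 → y + s • w ∉ convexHull ℝ (V : Set (Fin d → ℝ))) :
    ∃ F, Fac (convexHull ℝ (V : Set (Fin d → ℝ))) w F ∧ y + s₀ • w ∈ F := by
  classical
  set P := convexHull ℝ (V : Set (Fin d → ℝ)) with hP
  have hconv : Convex ℝ P := convex_convexHull ℝ _
  set R : Set (Fin d → ℝ) := openSegment ℝ (y + s₀ • w) (y + w) with hR
  have hRmem : ∀ s, s₀ < s → s < 1 → y + s • w ∈ R := by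
    intro s hs hs1
    refine ⟨(1 - s) / (1 - s₀), (s - s₀) / (1 - s₀), ?_, ?_, ?_, ?_⟩
    · exact div_pos (by linarith) (by linarith)
    · exact div_pos (by linarith) (by linarith)
    · have : 1 - s₀ ≠ 0 := by linarith
      field_simp; ring
    · have : 1 - s₀ ≠ 0 := by linarith
      ext i
      simp only [Pi.add_apply, Pi.smul_apply, smul_eq_mul]
      field_simp; ring
  have hdisj : Disjoint (interior P) R := by
    rw [Set.disjoint_right]
    rintro x ⟨a, b, ha, hb, hab, rfl⟩ hx
    refine hout (a * s₀ + b) ?_ ?_ ?_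
    · nlinarith
    · nlinarith
    · have : y + (a * s₀ + b) • w = a • (y + s₀ • w) + b • (y + w) := by
        ext i
        simp only [Pi.add_apply, Pi.smul_apply, smul_eq_mul]
        linear_combination (-(y i)) * hab
      rw [this]; exact interior_subset hx
  obtain ⟨f, c, hf1, hf2⟩ :=
    geometric_hahn_banach_open hconv.interior isOpen_interior (convex_openSegment _ _) hdisj
  have hfP : ∀ x ∈ P, f x ≤ c := by
    intro x hx
    have hx' : x ∈ closure (interior P) := by
      rw [hconv.closure_interior_eq_closure_of_nonempty_interior hinter]; exact subset_closure hx
    have hcl : IsClosed {x | f x ≤ c} := isClosed_le f.continuous continuous_const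
    exact hcl.closure_subset_iff.2 (fun z hz => (hf1 z hz).le) hx'
  have hpc : c ≤ f (y + s₀ • w) := by
    have hmem : y + s₀ • w ∈ closure R := by
      rw [hR, closure_openSegment]; exact left_mem_segment ℝ _ _
    have hcl : IsClosed {x | c ≤ f x} := isClosed_le continuous_const f.continuous
    exact hcl.closure_subset_iff.2 (fun z hz => hf2 z hz) hmem
  have hpc' : f (y + s₀ • w) = c := le_antisymm (hfP _ hp) hpc
  have hfw : 0 ≤ f w := by
    have := hf2 _ (hRmem ((s₀ + 1) / 2) (by linarith) (by linarith))
    rw [map_add, map_smul, smul_eq_mul] at this hpc'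
    nlinarith
  set f' : (Fin d → ℝ) →ₗ[ℝ] ℝ := f.toLinearMap with hf'
  have hff : ∀ x, f' x = f x := fun _ => rfl
  have hface := face_eq V f' c hfP
  set A := V.filter (fun v => f' v = c) with hA
  have hpA : y + s₀ • w ∈ affineSpan ℝ (A : Set (Fin d → ℝ)) := by
    apply convexHull_subset_affineSpan
    rw [← hface]; exact ⟨hp, hpc'⟩
  have hrank : d ≤ Module.finrank ℝ (affineSpan ℝ (A : Set (Fin d → ℝ))).direction + 1 := by
    by_contra hlt
    exact (hy A (Finset.filter_subset _ _)).1 (by omega) s₀ hpA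
  have hker : (affineSpan ℝ (A : Set (Fin d → ℝ))).direction ≤ LinearMap.ker f' := by
    rw [direction_affineSpan, vectorSpan_def, Submodule.span_le]
    rintro _ ⟨a, ha, b, hb, rfl⟩
    simp only [hA, Finset.coe_filter, Set.mem_ofPred_eq] at ha hb
    simp only [SetLike.mem_coe, LinearMap.mem_ker, vsub_eq_sub, map_sub, ha.2, hb.2, sub_self]
  have hf0 : f' ≠ 0 := by
    intro h0
    obtain ⟨x, hx⟩ := hinter
    have a1 := hf1 x hx
    rw [← hff, h0] at a1
    rw [← hff, h0] at hpc'
    simp at a1 hpc'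
    linarith
  have hkr : Module.finrank ℝ (LinearMap.ker f') < d := by
    have hlt : LinearMap.ker f' < ⊤ := by
      rw [lt_top_iff_ne_top]; intro h; exact hf0 (LinearMap.ker_eq_top.1 h)
    have := Submodule.finrank_lt hlt.ne
    simpa using this
  have hle := Submodule.finrank_mono hker
  have heq : (affineSpan ℝ (A : Set (Fin d → ℝ))).direction = LinearMap.ker f' :=
    Submodule.eq_of_le_of_finrank_eq hker (by omega)
  have hwn : w ∉ LinearMap.ker f' := by
    rw [← heq]; exact hw A (Finset.filter_subset _ _) (by omega)
  have hfw' : 0 < f w := lt_of_le_of_ne hfw (fun h => hwn (by rw [LinearMap.mem_ker, hff, ← h]))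
  refine ⟨{x ∈ P | f' x = c}, ⟨f', c, hfP, rfl, ?_, hfw'⟩, hp, hpc'⟩
  rw [hface, affineSpan_convexHull]
  omega

/-- crossing formula -/
theorem crossing {d : ℕ} (hd : 1 ≤ d) {V : Finset (Fin d → ℝ)} {w y : Fin d → ℝ}
    (hinter : (interior (convexHull ℝ (V : Set (Fin d → ℝ)))).Nonempty)
    (hw : GoodDir V w) (hy : GoodPt V w y) :
    (if Ex (convexHull ℝ (V : Set (Fin d → ℝ))) w y then (1 : ENNReal) else 0) =
      ∑ F ∈ (fac_finite V w).toFinset, (if Hit F w y then (1 : ENNReal) else 0) := by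
  classical
  set P := convexHull ℝ (V : Set (Fin d → ℝ)) with hP
  split_ifs with h
  · obtain ⟨⟨s, hs0, hs1, hsP⟩, hend⟩ := h
    have hPc : IsCompact P := (Finset.finite_toSet V).isCompact_convexHull ℝ
    set T : Set ℝ := Set.Icc 0 1 ∩ {s | y + s • w ∈ P} with hT
    have hTc : IsCompact T :=
      isCompact_Icc.inter_right (hPc.isClosed.preimage (by fun_prop))
    obtain ⟨s₀, hs₀, hmax⟩ := hTc.exists_isGreatest ⟨s, ⟨hs0, hs1⟩, hsP⟩
    have hlt : s₀ < 1 := by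
      refine lt_of_le_of_ne hs₀.1.2 ?_
      rintro rfl
      apply hend; simpa using hs₀.2
    have hout : ∀ s, s₀ < s → s ≤ 1 → y + s • w ∉ P := fun s h1 h2 h3 =>
      absurd (hmax ⟨⟨hs₀.1.1.trans h1.le, h2⟩, h3⟩) (not_le.2 h1)
    obtain ⟨F, hF, hpF⟩ := exists_exit hd hinter hw hy hlt hs₀.2 hout
    rw [Finset.sum_eq_single F]
    · rw [if_pos ⟨s₀, hs₀.1.1, hs₀.1.2, hpF⟩]
    · intro G hG hne
      rw [if_neg]
      rintro ⟨s₁, h0, h1, hsG⟩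
      have hG' : Fac P w G := by simpa using hG
      apply hne
      obtain ⟨g, e, g1, g2, g3, g4⟩ := id hG'
      have hsP1 : y + s₁ • w ∈ P := by rw [g2] at hsG; exact hsG.1
      have hle : s₁ ≤ s₀ := hmax ⟨⟨h0, h1⟩, hsP1⟩
      have hge : s₀ ≤ s₁ := by
        have e1 := g1 _ hs₀.2
        have e2 : g (y + s₁ • w) = e := by rw [g2] at hsG; exact hsG.2
        rw [map_add, map_smul, smul_eq_mul] at e1 e2
        nlinarith
      obtain rfl : s₁ = s₀ := le_antisymm hle hge
      exact fac_unique hd hG' hF hsG hpF (fun A hA hr => (hy A hA).1 hr _)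
    · intro hn; exact absurd (by simpa using hF) hn
  · symm
    apply Finset.sum_eq_zero
    intro F hF
    rw [if_neg]
    rintro ⟨s, h0, h1, hsF⟩
    have hF' : Fac P w F := by simpa using hF
    have hhull := hF'.eq_hull
    obtain ⟨g, e, g1, g2, g3, g4⟩ := id hF'
    have hsF' := hsF
    rw [g2] at hsF'
    apply h
    refine ⟨⟨s, h0, h1, hsF'.1⟩, fun hend => ?_⟩
    have e1 := g1 _ hend
    have e2 := hsF'.2
    rw [map_add, map_smul, smul_eq_mul] at e2
    rw [map_add] at e1
    have : s = 1 := le_antisymm h1 (by nlinarith)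
    subst this
    obtain ⟨A, hA, hFA⟩ := hhull
    refine (hy A hA).2 ?_ ?_
    · rw [hFA, affineSpan_convexHull] at g3; omega
    · rw [one_smul] at hsF
      rw [hFA] at hsF
      exact convexHull_subset_affineSpan _ hsF

/-- bookkeeping identity -/
theorem book {d : ℕ} (P : Set (Fin d → ℝ)) (w y : Fin d → ℝ) :
    (if y + w ∈ P then (1 : ENNReal) else 0) + (if Ex P w y then 1 else 0) =
      (if y ∈ P then (1 : ENNReal) else 0) + (if Ex P (-w) (y + w) then 1 else 0) := by
  have hsym : Hit P (-w) (y + w) ↔ Hit P w y := by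
    constructor
    · rintro ⟨s, h0, h1, h⟩
      refine ⟨1 - s, by linarith, by linarith, ?_⟩
      convert h using 1
      rw [sub_smul, one_smul, smul_neg]; abel
    · rintro ⟨s, h0, h1, h⟩
      refine ⟨1 - s, by linarith, by linarith, ?_⟩
      convert h using 1
      rw [sub_smul, one_smul, smul_neg]; abel
  have hy : y ∈ P → Hit P w y := fun h => ⟨0, le_rfl, zero_le_one, by simpa using h⟩
  have hyw : y + w ∈ P → Hit P w y := fun h => ⟨1, zero_le_one, le_rfl, by simpa using h⟩
  unfold Ex
  rw [hsym, add_neg_cancel_right]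
  by_cases a : y ∈ P <;> by_cases b : y + w ∈ P <;> by_cases c : Hit P w y <;> simp_all

/-- integer vectors as real vectors -/
def iv {d : ℕ} (n : Fin d → ℤ) : Fin d → ℝ := fun i => (n i : ℝ)

theorem iv_sub {d : ℕ} (m n : Fin d → ℤ) : iv (m - n) = iv m - iv n := by
  ext i; simp [iv]

/-- number of lattice points in `P - y` -/
noncomputable def Phi {d : ℕ} (P : Set (Fin d → ℝ)) (y : Fin d → ℝ) : ENNReal :=
  ∑' n : Fin d → ℤ, (if y + iv n ∈ P then (1 : ENNReal) else 0)

/-- number of exits -/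
noncomputable def Xi {d : ℕ} (P : Set (Fin d → ℝ)) (w y : Fin d → ℝ) : ENNReal :=
  ∑' n : Fin d → ℤ, (if Ex P w (y + iv n) then (1 : ENNReal) else 0)

theorem Phi_Xi {d : ℕ} (P : Set (Fin d → ℝ)) (w y : Fin d → ℝ) :
    Phi P (y + w) + Xi P w y = Phi P y + Xi P (-w) (y + w) := by
  unfold Phi Xi
  rw [← ENNReal.tsum_add, ← ENNReal.tsum_add]
  refine tsum_congr fun n => ?_
  have := book P w (y + iv n)
  rw [add_right_comm y w]
  exact this

theorem Xi_symm {d : ℕ} (hd : 1 ≤ d) {V : Finset (Fin d → ℝ)} {w y : Fin d → ℝ}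
    (hinter : (interior (convexHull ℝ (V : Set (Fin d → ℝ)))).Nonempty)
    (hsym : ∀ F, IsFacet (convexHull ℝ (V : Set (Fin d → ℝ))) F →
      ∃ m : Fin d → ℤ, ∀ x, x ∈ F → iv m - x ∈ F)
    (hw : GoodDir V w) (hy : ∀ n, GoodPt V w (y + iv n))
    (hy' : ∀ n, GoodPt V w (-y - w + iv n)) :
    Xi (convexHull ℝ (V : Set (Fin d → ℝ))) w y =
      Xi (convexHull ℝ (V : Set (Fin d → ℝ))) w (-y - w) := by
  unfold Xi
  rw [tsum_congr (fun n => crossing hd hinter hw (hy n)),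
    tsum_congr (fun n => crossing hd hinter hw (hy' n)),
    Summable.tsum_finsetSum (fun _ _ => ENNReal.summable),
    Summable.tsum_finsetSum (fun _ _ => ENNReal.summable)]
  refine Finset.sum_congr rfl fun F hF => ?_
  have hF' : Fac (convexHull ℝ (V : Set (Fin d → ℝ))) w F := by simpa using hF
  obtain ⟨m, hm⟩ := hsym F hF'.isFacet
  rw [← (Equiv.subLeft m).tsum_eq]
  refine tsum_congr fun n => ?_
  have : Hit F w (y + iv (Equiv.subLeft m n)) ↔ Hit F w (-y - w + iv n) := by
    rw [Equiv.subLeft_apply, iv_sub]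
    constructor
    · rintro ⟨s, h0, h1, h⟩
      refine ⟨1 - s, by linarith, by linarith, ?_⟩
      convert hm _ h using 1
      rw [sub_smul, one_smul]; abel
    · rintro ⟨s, h0, h1, h⟩
      refine ⟨1 - s, by linarith, by linarith, ?_⟩
      convert hm _ h using 1
      rw [sub_smul, one_smul]; abel
  simp only [this]

theorem finite_lattice {d : ℕ} (R : ℝ) (y : Fin d → ℝ) :
    {n : Fin d → ℤ | ‖y + iv n‖ ≤ R}.Finite := by
  refine (Set.finite_Icc (fun i => ⌊- R - y i⌋ : Fin d → ℤ) (fun i => ⌈R - y i⌉)).subset ?_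
  intro n hn
  have hn' : ∀ i, |y i + n i| ≤ R := fun i => (norm_le_pi_norm (y + iv n) i).trans hn
  constructor
  · intro i
    have := (abs_le.1 (hn' i)).1
    have h2 : ((⌊- R - y i⌋ : ℤ) : ℝ) ≤ n i := (Int.floor_le _).trans (by linarith)
    exact_mod_cast h2
  · intro i
    have := (abs_le.1 (hn' i)).2
    have h2 : (n i : ℝ) ≤ ((⌈R - y i⌉ : ℤ) : ℝ) := le_trans (by linarith) (Int.le_ceil _)
    exact_mod_cast h2

theorem tsum_ne_top {d : ℕ} (q : (Fin d → ℝ) → Prop) (R : ℝ) (hq : ∀ z, q z → ‖z‖ ≤ R)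
    (y : Fin d → ℝ) : ∑' n : Fin d → ℤ, (if q (y + iv n) then (1 : ENNReal) else 0) ≠ ⊤ := by
  rw [tsum_eq_sum (s := (finite_lattice R y).toFinset)]
  · refine (ENNReal.sum_lt_top.2 fun n _ => ?_).ne
    split_ifs <;> simp
  · intro n hn
    rw [if_neg]
    intro h
    exact hn (by simpa using hq _ h)

theorem Phi_inv {d : ℕ} (hd : 1 ≤ d) {V : Finset (Fin d → ℝ)} {w y : Fin d → ℝ}
    (hinter : (interior (convexHull ℝ (V : Set (Fin d → ℝ)))).Nonempty)
    (hsym : ∀ F, IsFacet (convexHull ℝ (V : Set (Fin d → ℝ))) F →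
      ∃ m : Fin d → ℤ, ∀ x, x ∈ F → iv m - x ∈ F)
    (hw : GoodDir V w) (hw' : GoodDir V (-w)) (hy1 : ∀ n, GoodPt V w (y + iv n))
    (hy2 : ∀ n, GoodPt V w (-y - w + iv n)) (hy3 : ∀ n, GoodPt V (-w) (y + w + iv n))
    (hy4 : ∀ n, GoodPt V (-w) (-y + iv n)) :
    Phi (convexHull ℝ (V : Set (Fin d → ℝ))) (y + w) +
      Phi (convexHull ℝ (V : Set (Fin d → ℝ))) (-(y + w)) =
    Phi (convexHull ℝ (V : Set (Fin d → ℝ))) y +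
      Phi (convexHull ℝ (V : Set (Fin d → ℝ))) (-y) := by
  set P := convexHull ℝ (V : Set (Fin d → ℝ)) with hP
  have hPc : IsCompact P := (Finset.finite_toSet V).isCompact_convexHull ℝ
  obtain ⟨R, hR⟩ := hPc.isBounded.exists_norm_le
  have fPhi : ∀ z, Phi P z ≠ ⊤ := fun z => tsum_ne_top (fun z => z ∈ P) R hR z
  have fXi : ∀ v z, Xi P v z ≠ ⊤ := by
    intro v z
    refine tsum_ne_top (fun z => Ex P v z) (R + ‖v‖) ?_ z
    rintro z ⟨⟨s, h0, h1, h⟩, -⟩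
    have e : z = (z + s • v) - s • v := by abel
    calc ‖z‖ = ‖(z + s • v) - s • v‖ := by rw [← e]
      _ ≤ ‖z + s • v‖ + ‖s • v‖ := norm_sub_le _ _
      _ ≤ R + ‖v‖ := by
        refine add_le_add (hR _ h) ?_
        rw [norm_smul, Real.norm_of_nonneg h0]
        exact mul_le_of_le_one_left (norm_nonneg _) h1
  have e1 := Phi_Xi P w y
  have e2 := Phi_Xi P w (-y - w)
  have s1 := Xi_symm hd hinter hsym hw hy1 hy2
  have s2 := Xi_symm (w := -w) (y := y + w) hd hinter hsym hw' hy3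
    (by intro n; convert hy4 n using 2; abel)
  rw [← hP] at s1 s2
  have r1 : -y - w + w = -y := by abel
  have r2 : -(y + w) - -w = -y := by abel
  have r3 : -(y + w) = -y - w := by abel
  rw [r1] at e2
  rw [r2] at s2
  rw [r3]
  rw [s2] at e1
  rw [← s1] at e2
  have fa := fPhi (y + w)
  have fb := fPhi y
  have fc := fPhi (-y)
  have fd := fPhi (-y - w)
  have fe := fXi w y
  have ff := fXi (-w) (-y)
  generalize Phi P (y + w) = a at *
  generalize Phi P y = b at *
  generalize Phi P (-y) = c at *
  generalize Phi P (-y - w) = e at *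
  generalize Xi P w y = k at *
  generalize Xi P (-w) (-y) = l at *
  lift a to NNReal using fa
  lift b to NNReal using fb
  lift c to NNReal using fc
  lift e to NNReal using fd
  lift k to NNReal using fe
  lift l to NNReal using ff
  norm_cast at e1 e2 ⊢
  have e1' := congrArg NNReal.toReal e1
  have e2' := congrArg NNReal.toReal e2
  apply NNReal.coe_injective
  push_cast at *
  linarith

theorem ae_goodDir {d : ℕ} (V : Finset (Fin d → ℝ)) :
    ∀ᵐ w : Fin d → ℝ, GoodDir V w := by
  have : ∀ᵐ w : Fin d → ℝ, ∀ A ∈ V.powerset,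
      Module.finrank ℝ (affineSpan ℝ (A : Set (Fin d → ℝ))).direction < d →
      w ∉ (affineSpan ℝ (A : Set (Fin d → ℝ))).direction := by
    rw [Filter.eventually_all_finset]
    intro A hA
    by_cases hr : Module.finrank ℝ (affineSpan ℝ (A : Set (Fin d → ℝ))).direction < d
    · have hne : (affineSpan ℝ (A : Set (Fin d → ℝ))).direction ≠ ⊤ := by
        intro h; rw [h, finrank_top] at hr; simp at hr
      have := Measure.addHaar_submodule volume _ hne
      filter_upwards [measure_eq_zero_iff_ae_notMem.1 this] with w hw _ using hw
    · exact Filter.Eventually.of_forall fun w h => absurd h hr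
  filter_upwards [this] with w hw A hA
  exact hw A (by simpa using hA)

theorem GoodDir.neg {d : ℕ} {V : Finset (Fin d → ℝ)} {w : Fin d → ℝ} (h : GoodDir V w) :
    GoodDir V (-w) := by
  intro A hA hr hm
  exact h A hA hr (by simpa using hm)

theorem ae_goodPt {d : ℕ} (V : Finset (Fin d → ℝ)) (w : Fin d → ℝ) :
    ∀ᵐ y : Fin d → ℝ, GoodPt V w y := by
  have : ∀ᵐ y : Fin d → ℝ, ∀ A ∈ V.powerset,
      (Module.finrank ℝ (affineSpan ℝ (A : Set (Fin d → ℝ))).direction + 1 < d →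
      ∀ s : ℝ, y + s • w ∉ affineSpan ℝ (A : Set (Fin d → ℝ))) ∧
    (Module.finrank ℝ (affineSpan ℝ (A : Set (Fin d → ℝ))).direction < d →
      y + w ∉ affineSpan ℝ (A : Set (Fin d → ℝ))) := by
    rw [Filter.eventually_all_finset]
    intro A hA
    set S := affineSpan ℝ (A : Set (Fin d → ℝ)) with hS
    rw [Filter.eventually_and]
    constructor
    · by_cases hr : Module.finrank ℝ S.direction + 1 < d
      · rcases Set.eq_empty_or_nonempty (S : Set (Fin d → ℝ)) with he | ⟨p, hp⟩
        · refine Filter.Eventually.of_forall fun y _ s h => ?_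
          rw [← SetLike.mem_coe, he] at h; exact h
        · set D := S.direction ⊔ Submodule.span ℝ {w} with hD
          have hDr : Module.finrank ℝ D < d := by
            have h1 := Submodule.finrank_add_le_finrank_add_finrank S.direction
              (Submodule.span ℝ {w})
            have h2 : Module.finrank ℝ (Submodule.span ℝ {w}) ≤ 1 := by
              simpa using finrank_span_le_card (R := ℝ) ({w} : Set (Fin d → ℝ))
            rw [← hD] at h1
            omega
          have hne : AffineSubspace.mk' p D ≠ ⊤ := by
            intro h
            have := congrArg AffineSubspace.direction h
            rw [AffineSubspace.direction_mk', AffineSubspace.direction_top] at this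
            rw [this, finrank_top] at hDr; simp at hDr
          have := Measure.addHaar_affineSubspace volume _ hne
          filter_upwards [measure_eq_zero_iff_ae_notMem.1 this] with y hy _ s hmem
          apply hy
          rw [SetLike.mem_coe, AffineSubspace.mem_mk', vsub_eq_sub]
          have e : y - p = (y + s • w - p) + (-s) • w := by rw [neg_smul]; abel
          rw [e]
          refine Submodule.add_mem_sup ?_ (Submodule.smul_mem _ _ (Submodule.mem_span_singleton_self w))
          exact AffineSubspace.vsub_mem_direction hmem hp
      · exact Filter.Eventually.of_forall fun y h => absurd h hr
    · by_cases hr : Module.finrank ℝ S.direction < d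
      · have hne : S ≠ ⊤ := by
          intro h; rw [h, AffineSubspace.direction_top, finrank_top] at hr; simp at hr
        have := Measure.addHaar_affineSubspace volume _ hne
        have h2 := measure_eq_zero_iff_ae_notMem.1 this
        have h3 := (measurePreserving_add_right (volume : Measure (Fin d → ℝ))
          w).quasiMeasurePreserving.ae h2
        filter_upwards [h3] with y hy _ using hy
      · exact Filter.Eventually.of_forall fun y h => absurd h hr
  filter_upwards [this] with w hw A hA
  exact hw A (by simpa using hA)

theorem ae_inv {d : ℕ} (hd : 1 ≤ d) {V : Finset (Fin d → ℝ)}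
    (hinter : (interior (convexHull ℝ (V : Set (Fin d → ℝ)))).Nonempty)
    (hsym : ∀ F, IsFacet (convexHull ℝ (V : Set (Fin d → ℝ))) F →
      ∃ m : Fin d → ℤ, ∀ x, x ∈ F → iv m - x ∈ F) :
    ∀ᵐ w : Fin d → ℝ, ∀ᵐ y : Fin d → ℝ,
    Phi (convexHull ℝ (V : Set (Fin d → ℝ))) (y + w) +
      Phi (convexHull ℝ (V : Set (Fin d → ℝ))) (-(y + w)) =
    Phi (convexHull ℝ (V : Set (Fin d → ℝ))) y +
      Phi (convexHull ℝ (V : Set (Fin d → ℝ))) (-y) := by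
  filter_upwards [ae_goodDir V] with w hw
  have pos : ∀ v c : Fin d → ℝ, ∀ᵐ y : Fin d → ℝ, GoodPt V v (y + c) := fun v c =>
    (measurePreserving_add_right (volume : Measure (Fin d → ℝ)) c).quasiMeasurePreserving.ae
      (ae_goodPt V v)
  have neg : ∀ v c : Fin d → ℝ, ∀ᵐ y : Fin d → ℝ, GoodPt V v (c - y) := fun v c =>
    (Measure.measurePreserving_sub_left (volume : Measure (Fin d → ℝ)) c).quasiMeasurePreserving.ae
      (ae_goodPt V v)
  have h1 := ae_all_iff.2 fun n : Fin d → ℤ => pos w (iv n)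
  have h2 := ae_all_iff.2 fun n : Fin d → ℤ => neg w (-w + iv n)
  have h3 := ae_all_iff.2 fun n : Fin d → ℤ => pos (-w) (w + iv n)
  have h4 := ae_all_iff.2 fun n : Fin d → ℤ => neg (-w) (iv n)
  filter_upwards [h1, h2, h3, h4] with y h1 h2 h3 h4
  refine Phi_inv hd hinter hsym hw hw.neg h1 ?_ ?_ ?_
  · intro n; convert h2 n using 1; abel
  · intro n; convert h3 n using 1; abel
  · intro n; convert h4 n using 1; abel

/-- half-open unit cube -/
def cube (d : ℕ) : Set (Fin d → ℝ) := Set.univ.pi fun _ => Set.Ico 0 1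

theorem cube_meas (d : ℕ) : MeasurableSet (cube d) :=
  MeasurableSet.univ_pi fun _ => measurableSet_Ico

theorem cube_vol (d : ℕ) : volume (cube d) = 1 := by
  simp [cube, volume_pi_pi]

theorem tsum_cube {d : ℕ} (h : (Fin d → ℝ) → ENNReal) :
    ∑' n : Fin d → ℤ, ∫⁻ w in cube d, h (w + iv n) = ∫⁻ w, h w := by
  have hS : ∀ n : Fin d → ℤ, MeasurableSet ((fun x => x + iv (-n)) ⁻¹' cube d) := fun n =>
    (measurable_add_const _) (cube_meas d)
  have hmem : ∀ (n : Fin d → ℤ) x, x ∈ ((fun x => x + iv (-n)) ⁻¹' cube d) ↔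
      (fun i => ⌊x i⌋) = n := by
    intro n x
    simp only [cube, Set.mem_preimage, Set.mem_univ_pi, Set.mem_Ico, funext_iff, Int.floor_eq_iff]
    refine forall_congr' fun i => ?_
    simp only [iv, Pi.add_apply, Pi.neg_apply, Int.cast_neg]
    constructor <;> rintro ⟨a, b⟩ <;> constructor <;> linarith
  have hdis : Pairwise (Function.onFun Disjoint
      fun n : Fin d → ℤ => (fun x => x + iv (-n)) ⁻¹' cube d) := by
    intro m n hmn
    rw [Function.onFun, Set.disjoint_left]
    intro x hx hx'
    exact hmn (((hmem m x).1 hx).symm.trans ((hmem n x).1 hx'))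
  have hun : (⋃ n : Fin d → ℤ, (fun x => x + iv (-n)) ⁻¹' cube d) = Set.univ := by
    rw [Set.eq_univ_iff_forall]
    intro x
    exact Set.mem_iUnion.2 ⟨fun i => ⌊x i⌋, (hmem _ x).2 rfl⟩
  have := lintegral_iUnion (μ := volume) hS hdis h
  rw [hun, Measure.restrict_univ] at this
  rw [this]
  refine tsum_congr fun n => ?_
  rw [← lintegral_indicator (cube_meas d), ← lintegral_indicator (hS n),
    ← lintegral_add_right_eq_self _ (iv (-n))]
  refine lintegral_congr fun x => ?_
  have e : x + iv (-n) + iv n = x := by ext i; simp [iv]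
  by_cases hx : x + iv (-n) ∈ cube d
  · rw [Set.indicator_of_mem hx, Set.indicator_of_mem (by exact hx), e]
  · rw [Set.indicator_of_notMem hx, Set.indicator_of_notMem (by exact hx)]

theorem Phi_meas {d : ℕ} {P : Set (Fin d → ℝ)} (hP : MeasurableSet P) : Measurable (Phi P) := by
  unfold Phi
  refine Measurable.tsum fun n => ?_
  refine Measurable.ite ?_ measurable_const measurable_const
  exact measurable_add_const (iv n) hP

theorem Phi_cube {d : ℕ} {P : Set (Fin d → ℝ)} (hP : MeasurableSet P) (y : Fin d → ℝ) :
    ∫⁻ w in cube d, Phi P (y + w) = volume P := by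
  unfold Phi
  rw [lintegral_tsum]
  · have := tsum_cube (fun w => if y + w ∈ P then (1 : ENNReal) else 0)
    simp only [← add_assoc] at this
    rw [this]
    have e := lintegral_add_left_eq_self (μ := (volume : Measure (Fin d → ℝ)))
      (fun w => if w ∈ P then (1 : ENNReal) else 0) y
    rw [e]
    have := lintegral_indicator_one (μ := (volume : Measure (Fin d → ℝ))) hP
    rw [← this]
    refine lintegral_congr fun x => ?_
    simp [Set.indicator_apply]
  · intro n
    refine (Measurable.ite ?_ measurable_const measurable_const).aemeasurable
    have : Measurable fun w : Fin d → ℝ => y + w + iv n := by fun_prop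
    exact this hP

theorem Phi_cube' {d : ℕ} {P : Set (Fin d → ℝ)} (hP : MeasurableSet P) (y : Fin d → ℝ) :
    ∫⁻ w in cube d, Phi P (-(y + w)) = volume P := by
  have hn : ∀ z, Phi P (-z) = Phi (-P) z := by
    intro z
    unfold Phi
    rw [← (Equiv.neg (Fin d → ℤ)).tsum_eq]
    refine tsum_congr fun n => ?_
    have : -z + iv (Equiv.neg (Fin d → ℤ) n) = -(z + iv n) := by
      ext i; simp [iv]; ring
    rw [this]; simp [Set.mem_neg]
  simp only [hn]
  rw [Phi_cube hP.neg, Measure.measure_neg]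

theorem core {d : ℕ} (hd : 1 ≤ d) {V : Finset (Fin d → ℝ)}
    (hinter : (interior (convexHull ℝ (V : Set (Fin d → ℝ)))).Nonempty)
    (hsym : ∀ F, IsFacet (convexHull ℝ (V : Set (Fin d → ℝ))) F →
      ∃ m : Fin d → ℤ, ∀ x, x ∈ F → iv m - x ∈ F)
    (B : Set (Fin d → ℝ)) (hB : MeasurableSet B) (hBs : ∀ x, -x ∈ B ↔ x ∈ B) :
    ∑' n : Fin d → ℤ, volume ({y | y - iv n ∈ B} ∩ convexHull ℝ (V : Set (Fin d → ℝ))) =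
      volume B * volume (convexHull ℝ (V : Set (Fin d → ℝ))) := by
  have hae := ae_inv hd hinter hsym
  have hPc : IsCompact (convexHull ℝ (V : Set (Fin d → ℝ))) :=
    (Finset.finite_toSet V).isCompact_convexHull ℝ
  have hPm := hPc.measurableSet
  generalize convexHull ℝ (V : Set (Fin d → ℝ)) = P at *
  have hΦ := Phi_meas hPm
  -- step 1
  have st1 : ∑' n : Fin d → ℤ, volume ({y | y - iv n ∈ B} ∩ P) = ∫⁻ y in B, Phi P y := by
    unfold Phi
    rw [lintegral_tsum]
    · refine tsum_congr fun n => ?_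
      rw [← measure_preimage_add_right volume (iv n) ({y | y - iv n ∈ B} ∩ P)]
      have hm : MeasurableSet {y | y + iv n ∈ P} := measurable_add_const (iv n) hPm
      have e : (fun h => h + iv n) ⁻¹' ({y | y - iv n ∈ B} ∩ P) = {y | y + iv n ∈ P} ∩ B := by
        ext y; simp [and_comm]
      rw [e, ← Measure.restrict_apply hm, ← lintegral_indicator_one hm]
      refine lintegral_congr fun x => ?_
      simp [Set.indicator_apply]
    · intro n
      refine (Measurable.ite ?_ measurable_const measurable_const).aemeasurable
      exact measurable_add_const (iv n) hPm
  have hneg : ∫⁻ y in B, Phi P (-y) = ∫⁻ y in B, Phi P y := by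
    rw [← lintegral_indicator hB, ← lintegral_indicator hB,
      ← lintegral_neg_eq_self (μ := volume) (B.indicator fun y => Phi P y)]
    refine lintegral_congr fun x => ?_
    simp only [Set.indicator_apply, hBs]
  set Z := ∫⁻ y in B, Phi P y with hZ
  have st2 : ∀ᵐ w : Fin d → ℝ,
      ∫⁻ y in B, (Phi P (y + w) + Phi P (-(y + w))) = 2 * Z := by
    filter_upwards [hae] with w hw
    rw [lintegral_congr_ae (ae_restrict_of_ae hw), lintegral_add_left hΦ, hneg, two_mul]
  have st3 : ∫⁻ w in cube d, ∫⁻ y in B, (Phi P (y + w) + Phi P (-(y + w))) = 2 * Z := by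
    rw [lintegral_congr_ae (ae_restrict_of_ae st2), lintegral_const, Measure.restrict_apply_univ,
      cube_vol, mul_one]
  have st4 : ∫⁻ w in cube d, ∫⁻ y in B, (Phi P (y + w) + Phi P (-(y + w))) =
      2 * (volume B * volume P) := by
    rw [lintegral_lintegral_swap]
    · have : ∀ y, ∫⁻ w in cube d, (Phi P (y + w) + Phi P (-(y + w))) = 2 * volume P := by
        intro y
        have hm : Measurable fun w => Phi P (y + w) := hΦ.comp (measurable_const_add y)
        rw [lintegral_add_left hm, Phi_cube hPm, Phi_cube' hPm,
          two_mul]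
      simp only [this]
      rw [lintegral_const, Measure.restrict_apply_univ]; ring
    · refine Measurable.aemeasurable ?_
      refine Measurable.add (hΦ.comp ?_) (hΦ.comp ?_)
      · exact measurable_snd.add measurable_fst
      · exact (measurable_snd.add measurable_fst).neg
  rw [st1]
  rw [st4] at st3
  exact ((ENNReal.mul_right_inj (by simp) (by simp)).1 st3).symm

theorem facet_int {d : ℕ} (V : Finset (Fin d → ℤ)) {F : Set (Fin d → ℝ)}
    (hF : IsFacet (convexHull ℝ ((V.image iv : Finset (Fin d → ℝ)) : Set (Fin d → ℝ))) F)
    (hc : CentrallySymm F) : ∃ m : Fin d → ℤ, ∀ x, x ∈ F → iv m - x ∈ F := by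
  classical
  obtain ⟨u, -, a, h1, h2, -⟩ := hF
  obtain ⟨c, hc⟩ := hc
  rcases Set.eq_empty_or_nonempty F with he | hne
  · exact ⟨0, fun x hx => by rw [he] at hx; exact hx.elim⟩
  let f : (Fin d → ℝ) →ₗ[ℝ] ℝ := ∑ i, u i • LinearMap.proj i
  have hf : ∀ x, f x = ∑ i, u i * x i := by intro x; simp [f]
  have hface := face_eq (V.image iv) f a (by intro x hx; rw [hf]; exact h1 x hx)
  have hF2 : F = convexHull ℝ
      (((V.image iv).filter (fun v => f v = a) : Finset _) : Set (Fin d → ℝ)) := by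
    rw [← hface, h2]; ext x; simp only [Set.mem_ofPred_eq, hf]
  have hcomp : IsCompact F := by
    rw [hF2]; exact (Finset.finite_toSet _).isCompact_convexHull ℝ
  have hrefl : ∀ x ∈ F, (2 : ℝ) • c - x ∈ F := by
    intro x hx; rw [← hc]; exact ⟨x, hx, rfl⟩
  have hinter : ∀ x ∈ Set.extremePoints ℝ F, ∃ n : Fin d → ℤ, iv n = x := by
    intro x hx
    rw [hF2] at hx
    have := extremePoints_convexHull_subset hx
    simp only [Finset.coe_filter, Set.mem_ofPred_eq, Finset.mem_image] at this
    obtain ⟨⟨n, -, hn⟩, -⟩ := this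
    exact ⟨n, hn⟩
  obtain ⟨v, hv⟩ := hcomp.extremePoints_nonempty hne
  have hv' : (2 : ℝ) • c - v ∈ Set.extremePoints ℝ F := by
    rw [mem_extremePoints] at hv ⊢
    refine ⟨hrefl v hv.1, ?_⟩
    rintro x hx z hz ⟨α, β, hα, hβ, hab, he⟩
    have := hv.2 _ (hrefl x hx) _ (hrefl z hz) ⟨α, β, hα, hβ, hab, by
      have h3 : v = (2 : ℝ) • c - (α • x + β • z) := by rw [he]; abel
      rw [h3, smul_sub, smul_sub]
      have h4 : (2 : ℝ) • c = α • (2 : ℝ) • c + β • (2 : ℝ) • c := by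
        rw [← add_smul, hab, one_smul]
      conv_rhs => rw [h4]
      abel⟩
    constructor
    · rw [← this.1]; abel
    · rw [← this.2]; abel
  obtain ⟨n, hn⟩ := hinter v hv
  obtain ⟨n', hn'⟩ := hinter _ hv'
  refine ⟨n + n', fun x hx => ?_⟩
  have : iv (n + n') = (2 : ℝ) • c := by
    have : iv (n + n') = iv n + iv n' := by ext i; simp [iv]
    rw [this, hn, hn']; abel
  rw [this]; exact hrefl x hx

theorem facet_scale {d : ℕ} {P F : Set (Fin d → ℝ)} {t : ℝ} (ht : 0 < t)
    (hF : IsFacet (t • P) F) : IsFacet P (t⁻¹ • F) := by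
  obtain ⟨u, hu, a, h1, h2, h3⟩ := hF
  have hs : ∀ (r : ℝ) (x : Fin d → ℝ), ∑ i, u i * (r • x) i = r * ∑ i, u i * x i := by
    intro r x; rw [Finset.mul_sum]; refine Finset.sum_congr rfl fun i _ => ?_
    simp only [Pi.smul_apply, smul_eq_mul]; ring
  refine ⟨u, hu, t⁻¹ * a, ?_, ?_, ?_⟩
  · intro x hx
    have := h1 (t • x) (Set.smul_mem_smul_set hx)
    rw [hs] at this
    rw [inv_mul_eq_div, le_div_iff₀ ht]; linarith
  · ext x
    rw [Set.mem_inv_smul_set_iff₀ ht.ne', h2]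
    simp only [Set.mem_ofPred_eq, hs, Set.smul_mem_smul_set_iff₀ ht.ne']
    rw [inv_mul_eq_div, eq_div_iff ht.ne', mul_comm]
  · rw [← h3]
    let e : (Fin d → ℝ) ≃ₗ[ℝ] (Fin d → ℝ) := LinearEquiv.smulOfNeZero ℝ _ t⁻¹ (inv_ne_zero ht.ne')
    have he : t⁻¹ • F = (e.toLinearMap.toAffineMap : (Fin d → ℝ) →ᵃ[ℝ] (Fin d → ℝ)) '' F := by
      rfl
    rw [he, ← AffineSubspace.map_span, AffineSubspace.map_direction]
    exact LinearEquiv.finrank_map_eq e _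

theorem eball_meas {d : ℕ} (c : Fin d → ℝ) (ε : ℝ) : MeasurableSet (eball c ε) := by
  unfold eball
  exact measurableSet_lt (by fun_prop) measurable_const

theorem eball_sub {d : ℕ} {c : Fin d → ℝ} {ε : ℝ} (hε : 0 < ε) {y : Fin d → ℝ}
    (hy : y ∈ eball c ε) : ‖y - c‖ ≤ ε := by
  rw [pi_norm_le_iff_of_nonneg hε.le]
  intro i
  have h1 : (y i - c i) ^ 2 ≤ ∑ i, (y i - c i) ^ 2 :=
    Finset.single_le_sum (f := fun i => (y i - c i) ^ 2) (fun i _ => sq_nonneg _)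
      (Finset.mem_univ i)
  have h2 : (y i - c i) ^ 2 < ε ^ 2 := lt_of_le_of_lt h1 hy
  exact (abs_lt_of_sq_lt_sq h2 hε.le).le

theorem eball_pos {d : ℕ} (c : Fin d → ℝ) {ε : ℝ} (hε : 0 < ε) : 0 < volume (eball c ε) := by
  have ho : IsOpen (eball c ε) := by
    unfold eball
    exact isOpen_lt (by fun_prop) continuous_const
  refine ho.measure_pos _ ⟨c, ?_⟩
  show ∑ i, (c i - c i) ^ 2 < ε ^ 2
  simp; positivity

theorem eball_fin {d : ℕ} (c : Fin d → ℝ) {ε : ℝ} (hε : 0 < ε) : volume (eball c ε) < ⊤ := by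
  refine lt_of_le_of_lt (measure_mono (t := Metric.closedBall c ε) ?_)
    measure_closedBall_lt_top
  intro y hy
  rw [Metric.mem_closedBall, dist_eq_norm]; exact eball_sub hε hy

theorem eball_pre {d : ℕ} (c : Fin d → ℝ) (ε : ℝ) :
    {y | y - c ∈ eball (0 : Fin d → ℝ) ε} = eball c ε := by
  ext y; simp [eball]

theorem eball_vol {d : ℕ} (c : Fin d → ℝ) (ε : ℝ) :
    volume (eball c ε) = volume (eball (0 : Fin d → ℝ) ε) := by
  rw [← eball_pre c ε]
  simp only [sub_eq_add_neg]
  exact measure_preimage_add_right volume (-c) (eball (0 : Fin d → ℝ) ε)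

theorem final {d : ℕ} (Q : Set (Fin d → ℝ)) (hQ : IsCompact Q)
    (hsum : ∀ ε : ℝ, 0 < ε → ∑' n : Fin d → ℤ, volume (eball (iv n) ε ∩ Q) =
      volume (eball (0 : Fin d → ℝ) ε) * volume Q)
    (ω : (Fin d → ℤ) → ℝ) (hω : ∀ n, saTendsto Q (iv n) (ω n)) :
    ∑' n, ω n = (volume Q).toReal := by
  obtain ⟨R, hR⟩ := hQ.isBounded.exists_norm_le
  set S := (finite_lattice (R + 1) (0 : Fin d → ℝ)).toFinset with hS
  have hemp : ∀ n ∉ S, ∀ ε : ℝ, 0 < ε → ε < 1 → eball (iv n) ε ∩ Q = ∅ := by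
    intro n hn ε h0 h1
    rw [Set.eq_empty_iff_forall_notMem]
    rintro y ⟨hy, hyQ⟩
    apply hn
    rw [hS, Set.Finite.mem_toFinset]
    show ‖0 + iv n‖ ≤ R + 1
    have e : (0 : Fin d → ℝ) + iv n = y - (y - iv n) := by abel
    rw [e]
    exact (norm_sub_le _ _).trans (add_le_add (hR y hyQ) ((eball_sub h0 hy).trans h1.le))
  have hev : ∀ᶠ ε : ℝ in nhdsWithin 0 (Set.Ioi 0), 0 < ε ∧ ε < 1 :=
    Ioo_mem_nhdsGT one_pos
  have hω0 : ∀ n ∉ S, ω n = 0 := by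
    intro n hn
    refine tendsto_nhds_unique (hω n) ?_
    refine tendsto_const_nhds.congr' ?_
    filter_upwards [hev] with ε hε
    rw [hemp n hn ε hε.1 hε.2]; simp
  rw [tsum_eq_sum hω0]
  have hlim := tendsto_finsetSum S (fun n _ => hω n)
  refine tendsto_nhds_unique hlim ?_
  refine tendsto_const_nhds.congr' ?_
  filter_upwards [hev] with ε hε
  have hs := hsum ε hε.1
  rw [tsum_eq_sum (s := S) (fun n hn => by rw [hemp n hn ε hε.1 hε.2]; simp)] at hs
  have hp := eball_pos (0 : Fin d → ℝ) hε.1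
  have hf := eball_fin (0 : Fin d → ℝ) hε.1
  have hs' := congrArg ENNReal.toReal hs
  rw [ENNReal.toReal_mul, ENNReal.toReal_sum] at hs'
  · simp only [eball_vol (iv _) ε]
    rw [← Finset.sum_div, hs', mul_div_cancel_left₀]
    exact (ENNReal.toReal_pos hp.ne' hf.ne).ne'
  · intro n _
    exact (lt_of_le_of_lt (measure_mono Set.inter_subset_left) (eball_fin _ hε.1)).ne

end Conc

/-- A full-dimensional integer polytope in `ℝ^d`, `d ≥ 3`, all of whose facets are centrally
symmetric, is a concrete polytope: `A_P(t) = vol(P)·t^d` for all positive integers `t`. -/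
theorem concrete_of_centrally_symmetric_facets (d : ℕ) (hd : 3 ≤ d)
    (V : Finset (Fin d → ℤ)) (P : Set (Fin d → ℝ))
    (hP : P = convexHull ℝ ((fun v : Fin d → ℤ => fun i => ((v i : ℝ))) '' (V : Set (Fin d → ℤ))))
    (hfull : (interior P).Nonempty)
    (hcs : ∀ F : Set (Fin d → ℝ), IsFacet P F → CentrallySymm F) :
    ∀ t : ℕ, 0 < t → ∀ ω : (Fin d → ℤ) → ℝ,
      (∀ n : Fin d → ℤ, saTendsto ((t : ℝ) • P) (fun i => (n i : ℝ)) (ω n)) →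
      ∑' n : Fin d → ℤ, ω n = (volume P).toReal * (t : ℝ) ^ d := by
  classical
  intro t ht ω hω
  have ht' : (0 : ℝ) < t := by exact_mod_cast ht
  have hP' : P = convexHull ℝ ((V.image Conc.iv : Finset (Fin d → ℝ)) : Set (Fin d → ℝ)) := by
    rw [hP, Finset.coe_image]; rfl
  set W : Finset (Fin d → ℝ) := (V.image Conc.iv).image (fun x => (t : ℝ) • x) with hW
  have hQ : (t : ℝ) • P = convexHull ℝ (W : Set (Fin d → ℝ)) := by
    rw [hP', ← convexHull_smul, hW, Finset.coe_image (f := fun x : Fin d → ℝ => (t : ℝ) • x)]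
    rfl
  have hinter : (interior (convexHull ℝ (W : Set (Fin d → ℝ)))).Nonempty := by
    rw [← hQ, interior_smul₀ ht'.ne']
    exact hfull.smul_set
  have hsym : ∀ F, IsFacet (convexHull ℝ (W : Set (Fin d → ℝ))) F →
      ∃ m : Fin d → ℤ, ∀ x, x ∈ F → Conc.iv m - x ∈ F := by
    intro F hF
    rw [← hQ] at hF
    have hF1 := Conc.facet_scale ht' hF
    have hc := hcs _ hF1
    rw [hP'] at hF1
    obtain ⟨m, hm⟩ := Conc.facet_int V hF1 hc
    refine ⟨(t : ℤ) • m, fun x hx => ?_⟩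
    have := hm _ (Set.smul_mem_smul_set (a := (t : ℝ)⁻¹) hx)
    rw [Set.mem_inv_smul_set_iff₀ ht'.ne', smul_sub, smul_inv_smul₀ ht'.ne'] at this
    convert this using 2
    ext i; simp [Conc.iv]
  have hcomp : IsCompact ((t : ℝ) • P) := by
    rw [hQ]; exact (Finset.finite_toSet W).isCompact_convexHull ℝ
  have hfin := Conc.final ((t : ℝ) • P) hcomp (fun ε hε => by
    have := Conc.core (by omega) hinter hsym (eball 0 ε) (Conc.eball_meas _ _)
      (by intro x; simp [eball])
    simp only [Conc.eball_pre] at this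
    rw [← hQ] at this
    exact this) ω hω
  rw [hfin, Measure.addHaar_smul, ENNReal.toReal_mul, mul_comm]
  congr 1
  rw [ENNReal.toReal_ofReal (abs_nonneg _), abs_of_nonneg (by positivity)]
  simp
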